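/- In the gradient descent setup with random initialization, for every δ ∈ (0,1), with probability at least 1 − δ over the random initialization, ‖(H∞ − H(0))P‖_P ≤ 2 M_I M_P n √(log(2n/δ)/m). -/

import Mathlib

open Matrix MeasureTheory ProbabilityTheory
open scoped ENNReal NNReal

noncomputable section

/-- `x̃ᵢ = (xᵢ, 1)/√2 ∈ ℝ^{d+1}`. -/
def tildeX {d n : ℕ} (x : Fin n → Fin d → ℝ) (i : Fin n) : Fin (d + 1) → ℝ :=
  fun j => (Fin.snoc (x i) 1 : Fin (d + 1) → ℝ) j / Real.sqrt 2

/-- `‖ξ‖_P = √(ξᵀ P ξ)`. -/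
def pNorm {n : ℕ} (P : Matrix (Fin n) (Fin n) ℝ) (ξ : Fin n → ℝ) : ℝ :=
  Real.sqrt (ξ ⬝ᵥ P *ᵥ ξ)

/-- Operator norm induced by `‖·‖_P`. -/
def pOpNorm {n : ℕ} (P A : Matrix (Fin n) (Fin n) ℝ) : ℝ :=
  sSup {c | ∃ ξ : Fin n → ℝ, pNorm P ξ = 1 ∧ c = pNorm P (A *ᵥ ξ)}

/-- Euclidean norm of a vector. -/
def vecNorm {ι : Type*} [Fintype ι] (ξ : ι → ℝ) : ℝ :=
  Real.sqrt (∑ j, ξ j * ξ j)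

/-- `M_I = sup {‖ξ‖_P : ‖ξ‖₂ = 1}`. -/
def constMI {n : ℕ} (P : Matrix (Fin n) (Fin n) ℝ) : ℝ :=
  sSup {c | ∃ ξ : Fin n → ℝ, vecNorm ξ = 1 ∧ c = pNorm P ξ}

/-- `M_P = sup {‖Pξ‖₂ : ‖ξ‖_P = 1}`. -/
def constMP {n : ℕ} (P : Matrix (Fin n) (Fin n) ℝ) : ℝ :=
  sSup {c | ∃ ξ : Fin n → ℝ, pNorm P ξ = 1 ∧ c = vecNorm (P *ᵥ ξ)}


/-- The limiting NTK matrix `H∞`. -/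
def Hinf {d n : ℕ} (x : Fin n → Fin d → ℝ) : Matrix (Fin n) (Fin n) ℝ :=
  Matrix.of fun i j =>
    (x i ⬝ᵥ x j + 1) * (Real.pi - Real.arccos (x i ⬝ᵥ x j)) / (4 * Real.pi)

/-- `H(0)` for a given weight configuration `W`. -/
def Hstep {d n m : ℕ} (x : Fin n → Fin d → ℝ) (W : Fin m → Fin (d + 1) → ℝ) :
    Matrix (Fin n) (Fin n) ℝ :=
  Matrix.of fun i j => (1 / (m : ℝ)) * (tildeX x i ⬝ᵥ tildeX x j) *
    ∑ r, (if 0 ≤ W r ⬝ᵥ tildeX x i then (1 : ℝ) else 0) *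
         (if 0 ≤ W r ⬝ᵥ tildeX x j then (1 : ℝ) else 0)

/-- The i.i.d. Gaussian law of the first-layer weights `w_1(0), …, w_m(0)`,
each `N(0, κ² I_d)`. -/
def gaussVec (d m : ℕ) (κ : ℝ) : Measure (Fin m → Fin d → ℝ) :=
  Measure.pi fun _ => Measure.pi fun _ => gaussianReal 0 (Real.toNNReal (κ ^ 2))

/-- Initial tilde-weights `w̃_r(0) = (w_r(0), 0)`. -/
def tildeW0 {d m : ℕ} (W : Fin m → Fin d → ℝ) : Fin m → Fin (d + 1) → ℝ :=
  fun r => (Fin.snoc (W r) 0 : Fin (d + 1) → ℝ)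

lemma charFun_gaussianReal_zero (v : ℝ≥0) (t : ℝ) :
    ∫ x, Complex.exp (t * x * Complex.I) ∂(gaussianReal 0 v) =
      Complex.exp (-(v * t ^ 2 / 2 : ℝ)) := by
  rw [← charFun_apply_real, charFun_gaussianReal]
  congr 1
  push_cast
  ring

lemma map_dotProduct_pi_gaussianReal {ι : Type*} [Fintype ι] (v : ℝ≥0) (x y : ι → ℝ) (θ : ℝ)
    (hx : x ⬝ᵥ x = 1) (hy : y ⬝ᵥ y = 1) (hxy : x ⬝ᵥ y = Real.cos θ) :
    (Measure.pi fun _ : ι => gaussianReal 0 v).map (fun w => (w ⬝ᵥ x, w ⬝ᵥ y)) =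
      ((gaussianReal 0 v).prod (gaussianReal 0 v)).map
        (fun z => (z.1, z.1 * Real.cos θ + z.2 * Real.sin θ)) := by
  have hm1 : Measurable (fun w : ι → ℝ => (w ⬝ᵥ x, w ⬝ᵥ y)) := by
    unfold dotProduct; fun_prop
  have hm2 : Measurable (fun z : ℝ × ℝ => (z.1, z.1 * Real.cos θ + z.2 * Real.sin θ)) := by
    fun_prop
  have := Measure.isProbabilityMeasure_map (μ := Measure.pi fun _ : ι => gaussianReal 0 v)
    hm1.aemeasurable
  have := Measure.isProbabilityMeasure_map (μ := (gaussianReal 0 v).prod (gaussianReal 0 v))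
    hm2.aemeasurable
  refine Measure.ext_of_charFunDual (funext fun L => ?_)
  obtain ⟨a, b, hL⟩ : ∃ a b : ℝ, ∀ s t : ℝ, L (s, t) = a * s + b * t := by
    refine ⟨L (1, 0), L (0, 1), fun s t => ?_⟩
    have : ((s, t) : ℝ × ℝ) = s • (1, 0) + t • (0, 1) := by simp
    rw [this, map_add, map_smul, map_smul]
    simp [mul_comm]
  rw [charFunDual_apply, charFunDual_apply, integral_map hm1.aemeasurable (by fun_prop),
    integral_map hm2.aemeasurable (by fun_prop)]
  have h1 : ∀ w : ι → ℝ, Complex.exp (L (w ⬝ᵥ x, w ⬝ᵥ y) * Complex.I) =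
      ∏ k, Complex.exp ((a * x k + b * y k : ℝ) * w k * Complex.I) := by
    intro w
    rw [← Complex.exp_sum, hL]
    congr 1
    simp only [dotProduct]
    push_cast
    rw [← Finset.sum_mul, Finset.mul_sum, Finset.mul_sum, ← Finset.sum_add_distrib]
    congr 1
    exact Finset.sum_congr rfl fun k _ => by ring
  have h2 : ∀ z : ℝ × ℝ,
      Complex.exp (L (z.1, z.1 * Real.cos θ + z.2 * Real.sin θ) * Complex.I) =
      Complex.exp ((a + b * Real.cos θ : ℝ) * z.1 * Complex.I) *
        Complex.exp ((b * Real.sin θ : ℝ) * z.2 * Complex.I) := by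
    intro z
    rw [← Complex.exp_add, hL]
    congr 1
    push_cast
    ring
  simp_rw [h1, h2]
  rw [integral_fintype_prod_eq_prod (μ := fun _ : ι => gaussianReal 0 v)
      (fun k (u : ℝ) => Complex.exp ((a * x k + b * y k : ℝ) * u * Complex.I)),
    integral_prod_mul (μ := gaussianReal 0 v) (ν := gaussianReal 0 v)
      (fun u : ℝ => Complex.exp ((a + b * Real.cos θ : ℝ) * u * Complex.I))
      (fun u : ℝ => Complex.exp ((b * Real.sin θ : ℝ) * u * Complex.I))]
  simp_rw [charFun_gaussianReal_zero]
  rw [← Complex.exp_add, ← Complex.exp_sum]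
  congr 1
  rw [Finset.sum_neg_distrib, ← neg_add, ← Complex.ofReal_add, ← Complex.ofReal_sum]
  congr 2
  have h3 : ∑ k, (v : ℝ) * (a * x k + b * y k) ^ 2 / 2 =
      v * (a ^ 2 * (x ⬝ᵥ x) + 2 * a * b * (x ⬝ᵥ y) + b ^ 2 * (y ⬝ᵥ y)) / 2 := by
    simp only [dotProduct, Finset.mul_sum, ← Finset.sum_add_distrib, Finset.sum_div]
    exact Finset.sum_congr rfl fun k _ => by ring
  rw [h3, hx, hy, hxy]
  linear_combination (-(v : ℝ) * b ^ 2 / 2) * Real.sin_sq_add_cos_sq θ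

lemma gaussianPDF_mul_polarCoord_symm (v : ℝ≥0) (p : ℝ × ℝ) :
    gaussianPDF 0 v (polarCoord.symm p).1 * gaussianPDF 0 v (polarCoord.symm p).2 =
      gaussianPDF 0 v p.1 * gaussianPDF 0 v 0 := by
  simp only [gaussianPDF, ← ENNReal.ofReal_mul (gaussianPDFReal_nonneg 0 v _)]
  simp only [gaussianPDFReal, polarCoord_symm_apply]
  congr 1
  rw [mul_mul_mul_comm, mul_mul_mul_comm _ (Real.exp _), ← Real.exp_add, ← Real.exp_add]
  congr 2
  rw [← add_div, ← add_div]
  congr 1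
  linear_combination (-p.1 ^ 2) * Real.sin_sq_add_cos_sq p.2

lemma gaussianReal_prod_apply_polar {v : ℝ≥0} (hv : v ≠ 0) {S : Set (ℝ × ℝ)} {B : Set ℝ}
    (hS : MeasurableSet S) (hB : MeasurableSet B)
    (h : ∀ p ∈ polarCoord.target, polarCoord.symm p ∈ S ↔ p.2 ∈ B) :
    ((gaussianReal 0 v).prod (gaussianReal 0 v)) S =
      (∫⁻ r in Set.Ioi (0 : ℝ), ENNReal.ofReal r * (gaussianPDF 0 v r * gaussianPDF 0 v 0)) *
        volume (B ∩ Set.Ioo (-Real.pi) Real.pi) := by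
  have hg : Measurable (gaussianPDF 0 v) := measurable_gaussianPDF 0 v
  rw [gaussianReal_of_var_ne_zero 0 hv, prod_withDensity hg hg, withDensity_apply _ hS,
    ← lintegral_indicator hS, ← Measure.volume_eq_prod, ← lintegral_comp_polarCoord_symm]
  have h1 : ∀ p ∈ polarCoord.target,
      ENNReal.ofReal p.1 • S.indicator (fun z => gaussianPDF 0 v z.1 * gaussianPDF 0 v z.2)
          (polarCoord.symm p) =
        (ENNReal.ofReal p.1 * (gaussianPDF 0 v p.1 * gaussianPDF 0 v 0)) *
          B.indicator 1 p.2 := by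
    intro p hp
    by_cases hpB : p.2 ∈ B
    · rw [Set.indicator_of_mem ((h p hp).2 hpB), Set.indicator_of_mem hpB,
        gaussianPDF_mul_polarCoord_symm]
      simp
    · rw [Set.indicator_of_notMem (fun hc => hpB ((h p hp).1 hc)), Set.indicator_of_notMem hpB]
      simp
  rw [setLIntegral_congr_fun polarCoord.open_target.measurableSet h1, polarCoord_target,
    Measure.volume_eq_prod, ← Measure.prod_restrict,
    lintegral_prod_mul (f := fun r => ENNReal.ofReal r * (gaussianPDF 0 v r * gaussianPDF 0 v 0))
      (g := B.indicator 1) (by fun_prop) (by exact (measurable_one.indicator hB).aemeasurable),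
    lintegral_indicator_one hB, Measure.restrict_apply hB]

lemma gaussianReal_prod_apply_angle {v : ℝ≥0} (hv : v ≠ 0) {S : Set (ℝ × ℝ)} {B : Set ℝ}
    (hS : MeasurableSet S) (hB : MeasurableSet B)
    (h : ∀ p ∈ polarCoord.target, polarCoord.symm p ∈ S ↔ p.2 ∈ B) :
    ((gaussianReal 0 v).prod (gaussianReal 0 v)) S =
      volume (B ∩ Set.Ioo (-Real.pi) Real.pi) / ENNReal.ofReal (2 * Real.pi) := by
  have h0 := gaussianReal_prod_apply_polar hv MeasurableSet.univ MeasurableSet.univ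
    (fun p _ => by simp)
  rw [measure_univ, Set.univ_inter, Real.volume_Ioo, sub_neg_eq_add, ← two_mul] at h0
  rw [gaussianReal_prod_apply_polar hv hS hB h, ENNReal.eq_inv_of_mul_eq_one_left h0.symm,
    mul_comm, ENNReal.div_eq_inv_mul, mul_comm]

lemma gaussianReal_prod_quadrant {v : ℝ≥0} (hv : v ≠ 0) {θ : ℝ} (h0 : 0 ≤ θ) (hπ : θ ≤ Real.pi) :
    ((gaussianReal 0 v).prod (gaussianReal 0 v))
      {z | 0 ≤ z.1 ∧ 0 ≤ z.1 * Real.cos θ + z.2 * Real.sin θ} =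
      ENNReal.ofReal ((Real.pi - θ) / (2 * Real.pi)) := by
  have hpi := Real.pi_pos
  rw [gaussianReal_prod_apply_angle hv (B := {φ | 0 ≤ Real.cos φ ∧ 0 ≤ Real.cos (φ - θ)})]
  · rw [ENNReal.ofReal_div_of_pos (by positivity)]
    congr 1
    have hsub1 : Set.Ioo (θ - Real.pi / 2) (Real.pi / 2) ⊆
        {φ | 0 ≤ Real.cos φ ∧ 0 ≤ Real.cos (φ - θ)} ∩ Set.Ioo (-Real.pi) Real.pi := by
      rintro φ ⟨h1, h2⟩
      exact ⟨⟨Real.cos_nonneg_of_neg_pi_div_two_le_of_le (by linarith) (by linarith),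
        Real.cos_nonneg_of_neg_pi_div_two_le_of_le (by linarith) (by linarith)⟩,
        by linarith, by linarith⟩
    have hsub2 : {φ | 0 ≤ Real.cos φ ∧ 0 ≤ Real.cos (φ - θ)} ∩ Set.Ioo (-Real.pi) Real.pi ⊆
        Set.Icc (θ - Real.pi / 2) (Real.pi / 2) ∪ {-(Real.pi / 2)} := by
      rintro φ ⟨⟨h1, h2⟩, h3, h4⟩
      have h5 : φ ≤ Real.pi / 2 := by
        by_contra! hc
        exact absurd h1 (not_le.2 (Real.cos_neg_of_pi_div_two_lt_of_lt hc (by linarith)))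
      have h6 : -(Real.pi / 2) ≤ φ := by
        by_contra! hc
        refine absurd h1 (not_le.2 ?_)
        rw [← Real.cos_neg]
        exact Real.cos_neg_of_pi_div_two_lt_of_lt (by linarith) (by linarith)
      rcases h6.eq_or_lt with h6 | h6
      · exact Or.inr h6.symm
      · refine Or.inl ⟨?_, h5⟩
        by_contra! hc
        refine absurd h2 (not_le.2 ?_)
        rw [← Real.cos_neg]
        exact Real.cos_neg_of_pi_div_two_lt_of_lt (by linarith) (by linarith)
    refine le_antisymm ((measure_mono hsub2).trans ((measure_union_le _ _).trans ?_)) ?_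
    · rw [Real.volume_Icc, Real.volume_singleton, add_zero]
      exact ENNReal.ofReal_le_ofReal (by linarith)
    · refine le_trans ?_ (measure_mono hsub1)
      rw [Real.volume_Ioo]
      exact ENNReal.ofReal_le_ofReal (by linarith)
  · exact (measurableSet_le measurable_const measurable_fst).inter (measurableSet_le
      measurable_const ((measurable_fst.mul_const _).add (measurable_snd.mul_const _)))
  · exact (measurableSet_le measurable_const Real.measurable_cos).inter (measurableSet_le
      measurable_const (Real.measurable_cos.comp (measurable_id.sub_const θ)))
  · rintro ⟨r, φ⟩ ⟨hr, -⟩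
    have hr : 0 < r := hr
    have : r * Real.cos φ * Real.cos θ + r * Real.sin φ * Real.sin θ = r * Real.cos (φ - θ) := by
      rw [Real.cos_sub]; ring
    simp only [polarCoord_symm_apply, Set.mem_ofPred_eq, this, mul_nonneg_iff_of_pos_left hr]

lemma measureReal_pi_sum_sub_integral_ge_le {Ω : Type*} {mΩ : MeasurableSpace Ω} (ν : Measure Ω)
    [IsProbabilityMeasure ν] {m : ℕ} {f : Ω → ℝ} (hf : Measurable f)
    (hf01 : ∀ ω, f ω ∈ Set.Icc (0 : ℝ) 1) {ε : ℝ} (hε : 0 ≤ ε) :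
    (Measure.pi fun _ : Fin m => ν).real {W | ε ≤ ∑ r, (f (W r) - ∫ ω, f ω ∂ν)} ≤
      Real.exp (-(2 * ε ^ 2 / m)) := by
  have hind : iIndepFun (fun (r : Fin m) (W : Fin m → Ω) => f (W r) - ∫ ω, f ω ∂ν)
      (Measure.pi fun _ : Fin m => ν) :=
    iIndepFun_pi (μ := fun _ : Fin m => ν) (X := fun _ ω => f ω - ∫ ω, f ω ∂ν)
      fun _ => (hf.sub_const _).aemeasurable
  have hsub : ∀ r ∈ (Finset.univ : Finset (Fin m)),
      HasSubgaussianMGF (fun W : Fin m → Ω => f (W r) - ∫ ω, f ω ∂ν)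
        ((‖(1 : ℝ) - 0‖₊ / 2) ^ 2) (Measure.pi fun _ : Fin m => ν) := by
    intro r _
    have h := hasSubgaussianMGF_of_mem_Icc (μ := Measure.pi fun _ : Fin m => ν)
      (X := fun W => f (W r)) (a := 0) (b := 1) (hf.comp (measurable_pi_apply r)).aemeasurable (.of_forall fun W => hf01 (W r))
    rwa [integral_comp_eval (μ := fun _ : Fin m => ν) hf.aestronglyMeasurable] at h
  refine (HasSubgaussianMGF.measure_sum_ge_le_of_iIndepFun hind hsub hε).trans_eq ?_
  congr 1
  rcases eq_or_ne m 0 with rfl | hm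
  · simp
  · simp
    field_simp

lemma measureReal_pi_abs_sum_sub_integral_ge_le {Ω : Type*} {mΩ : MeasurableSpace Ω}
    (ν : Measure Ω) [IsProbabilityMeasure ν] {m : ℕ} {f : Ω → ℝ} (hf : Measurable f)
    (hf01 : ∀ ω, f ω ∈ Set.Icc (0 : ℝ) 1) {ε : ℝ} (hε : 0 ≤ ε) :
    (Measure.pi fun _ : Fin m => ν).real {W | ε ≤ |∑ r, (f (W r) - ∫ ω, f ω ∂ν)|} ≤
      2 * Real.exp (-(2 * ε ^ 2 / m)) := by
  have hint : Integrable f ν := .of_mem_Icc 0 1 hf.aemeasurable (.of_forall hf01)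
  have h1 := measureReal_pi_sum_sub_integral_ge_le ν (m := m) hf hf01 hε
  have h2 := measureReal_pi_sum_sub_integral_ge_le ν (m := m) (f := fun ω => 1 - f ω)
    (hf.const_sub 1) (fun ω => ⟨by linarith [(hf01 ω).2], by linarith [(hf01 ω).1]⟩) hε
  rw [integral_sub (integrable_const _) hint] at h2
  simp only [integral_const, probReal_univ, one_smul, sub_sub_sub_cancel_left] at h2
  calc _ ≤ (Measure.pi fun _ : Fin m => ν).real
        ({W | ε ≤ ∑ r, (f (W r) - ∫ ω, f ω ∂ν)} ∪ {W | ε ≤ ∑ r, (∫ ω, f ω ∂ν - f (W r))}) := by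
        refine measureReal_mono (fun W hW => ?_)
        rcases le_abs.1 (show ε ≤ |∑ r, (f (W r) - ∫ ω, f ω ∂ν)| from hW) with h | h
        · exact Or.inl h
        · refine Or.inr ?_
          rw [← Finset.sum_neg_distrib] at h
          simp only [neg_sub] at h
          exact h
    _ ≤ _ := (measureReal_union_le _ _).trans (by linarith)

lemma vecNorm_nonneg {ι : Type*} [Fintype ι] (u : ι → ℝ) : 0 ≤ vecNorm u := Real.sqrt_nonneg _

lemma vecNorm_mulVec_le {n : ℕ} {A : Matrix (Fin n) (Fin n) ℝ} {t : ℝ} (ht : 0 ≤ t)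
    (hA : ∀ i j, |A i j| ≤ t) (u : Fin n → ℝ) : vecNorm (A *ᵥ u) ≤ n * t * vecNorm u := by
  refine Real.sqrt_le_iff.2 ⟨by have := vecNorm_nonneg u; positivity, ?_⟩
  rw [mul_pow, vecNorm, Real.sq_sqrt (Finset.sum_nonneg fun j _ => mul_self_nonneg _)]
  have hrow : ∀ i, (A *ᵥ u) i * (A *ᵥ u) i ≤ n * t ^ 2 * ∑ j, u j * u j := by
    intro i
    have hcs := Finset.sum_mul_sq_le_sq_mul_sq Finset.univ (A i) u
    have hsq : ∑ j, A i j ^ 2 ≤ n * t ^ 2 := by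
      refine (Finset.sum_le_sum fun j _ => sq_le_sq' (abs_le.1 (hA i j)).1
        (abs_le.1 (hA i j)).2).trans_eq ?_
      simp
    simp only [← sq]
    exact hcs.trans (mul_le_mul_of_nonneg_right hsq (Finset.sum_nonneg fun j _ => sq_nonneg _))
  refine (Finset.sum_le_sum fun i _ => hrow i).trans_eq ?_
  simp only [Finset.sum_const, Finset.card_univ, Fintype.card_fin, nsmul_eq_mul]
  ring

lemma exists_vecNorm_mulVec_le {n : ℕ} (A : Matrix (Fin n) (Fin n) ℝ) :
    ∃ C, 0 ≤ C ∧ ∀ u, vecNorm (A *ᵥ u) ≤ C * vecNorm u := by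
  have h0 : 0 ≤ ∑ i, ∑ j, |A i j| :=
    Finset.sum_nonneg fun i _ => Finset.sum_nonneg fun j _ => abs_nonneg _
  refine ⟨n * ∑ i, ∑ j, |A i j|, by positivity, vecNorm_mulVec_le h0 fun i j => ?_⟩
  exact (Finset.single_le_sum (f := fun j => |A i j|) (fun j _ => abs_nonneg _)
    (Finset.mem_univ j)).trans (Finset.single_le_sum (f := fun i => ∑ j, |A i j|)
      (fun i _ => Finset.sum_nonneg fun j _ => abs_nonneg _) (Finset.mem_univ i))

open scoped MatrixOrder in
lemma Matrix.PosSemidef.exists_pNorm_eq {n : ℕ} {P : Matrix (Fin n) (Fin n) ℝ}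
    (hP : P.PosSemidef) :
    ∃ B : Matrix (Fin n) (Fin n) ℝ, P = Bᵀ * B ∧ ∀ ξ, pNorm P ξ = vecNorm (B *ᵥ ξ) := by
  obtain ⟨B, hB⟩ := CStarAlgebra.nonneg_iff_eq_star_mul_self.1 hP.nonneg
  refine ⟨B, hB, fun ξ => ?_⟩
  have h : P = Bᵀ * B := hB
  change Real.sqrt _ = Real.sqrt ((B *ᵥ ξ) ⬝ᵥ (B *ᵥ ξ))
  rw [h, ← mulVec_mulVec, dotProduct_mulVec, vecMul_transpose]

lemma vecNorm_smul {ι : Type*} [Fintype ι] (c : ℝ) (u : ι → ℝ) :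
    vecNorm (c • u) = |c| * vecNorm u := by
  rw [vecNorm, vecNorm, ← Real.sqrt_sq_eq_abs, ← Real.sqrt_mul (sq_nonneg c), Finset.mul_sum]
  congr 1
  exact Finset.sum_congr rfl fun j _ => by simp only [Pi.smul_apply, smul_eq_mul]; ring

lemma pNorm_le_constMI_mul {n : ℕ} {P : Matrix (Fin n) (Fin n) ℝ} (hP : P.PosSemidef)
    (ξ : Fin n → ℝ) : pNorm P ξ ≤ constMI P * vecNorm ξ := by
  obtain ⟨B, -, hB⟩ := hP.exists_pNorm_eq
  obtain ⟨C, -, hC⟩ := exists_vecNorm_mulVec_le B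
  rcases (vecNorm_nonneg ξ).eq_or_lt with h0 | hpos
  · have := hC ξ
    rw [← h0, mul_zero] at this ⊢
    rwa [hB]
  · have hbdd : BddAbove {c | ∃ ξ : Fin n → ℝ, vecNorm ξ = 1 ∧ c = pNorm P ξ} := by
      refine ⟨C, ?_⟩
      rintro c ⟨η, hη, rfl⟩
      simpa [hB, hη] using hC η
    have hle : pNorm P ((vecNorm ξ)⁻¹ • ξ) ≤ constMI P := by
      refine le_csSup hbdd ⟨_, ?_, rfl⟩
      rw [vecNorm_smul, abs_of_pos (inv_pos.2 hpos), inv_mul_cancel₀ hpos.ne']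
    rw [hB, mulVec_smul, vecNorm_smul, abs_of_pos (inv_pos.2 hpos), ← hB, inv_mul_eq_div,
      div_le_iff₀ hpos] at hle
    exact hle

lemma vecNorm_mulVec_le_constMP {n : ℕ} {P : Matrix (Fin n) (Fin n) ℝ} (hP : P.PosSemidef)
    {ξ : Fin n → ℝ} (hξ : pNorm P ξ = 1) : vecNorm (P *ᵥ ξ) ≤ constMP P := by
  obtain ⟨B, hPB, hB⟩ := hP.exists_pNorm_eq
  obtain ⟨C, -, hC⟩ := exists_vecNorm_mulVec_le Bᵀ
  refine le_csSup ⟨C, ?_⟩ ⟨ξ, hξ, rfl⟩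
  rintro c ⟨η, hη, rfl⟩
  have := hC (B *ᵥ η)
  rwa [mulVec_mulVec, ← hPB, ← hB, hη, mul_one] at this

lemma constMI_nonneg {n : ℕ} (P : Matrix (Fin n) (Fin n) ℝ) : 0 ≤ constMI P :=
  Real.sSup_nonneg (by rintro c ⟨ξ, -, rfl⟩; exact Real.sqrt_nonneg _)

lemma constMP_nonneg {n : ℕ} (P : Matrix (Fin n) (Fin n) ℝ) : 0 ≤ constMP P :=
  Real.sSup_nonneg (by rintro c ⟨ξ, -, rfl⟩; exact Real.sqrt_nonneg _)

lemma pOpNorm_mul_le {n : ℕ} {P A : Matrix (Fin n) (Fin n) ℝ} (hP : P.PosSemidef) {t : ℝ}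
    (ht : 0 ≤ t) (hA : ∀ i j, |A i j| ≤ t) :
    pOpNorm P (A * P) ≤ constMI P * (n * t * constMP P) := by
  have hMI := constMI_nonneg P
  have hMP := constMP_nonneg P
  refine Real.sSup_le ?_ (by positivity)
  rintro c ⟨ξ, hξ, rfl⟩
  rw [← mulVec_mulVec]
  refine (pNorm_le_constMI_mul hP _).trans (mul_le_mul_of_nonneg_left ?_ hMI)
  exact (vecNorm_mulVec_le ht hA _).trans
    (mul_le_mul_of_nonneg_left (vecNorm_mulVec_le_constMP hP hξ) (by positivity))

lemma tildeX_dotProduct_tildeX {d n : ℕ} (x : Fin n → Fin d → ℝ) (i j : Fin n) :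
    tildeX x i ⬝ᵥ tildeX x j = (x i ⬝ᵥ x j + 1) / 2 := by
  simp only [dotProduct, tildeX, Fin.sum_univ_castSucc, Fin.snoc_castSucc, Fin.snoc_last,
    div_mul_div_comm, Real.mul_self_sqrt zero_le_two, ← Finset.sum_div, mul_one, add_div]

lemma tildeW0_dotProduct_tildeX_nonneg {d n m : ℕ} (x : Fin n → Fin d → ℝ)
    (W : Fin m → Fin d → ℝ) (r : Fin m) (i : Fin n) :
    0 ≤ tildeW0 W r ⬝ᵥ tildeX x i ↔ 0 ≤ W r ⬝ᵥ x i := by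
  have h : tildeW0 W r ⬝ᵥ tildeX x i = (W r ⬝ᵥ x i) / Real.sqrt 2 := by
    simp only [dotProduct, tildeX, tildeW0, Fin.sum_univ_castSucc, Fin.snoc_castSucc,
      Fin.snoc_last, zero_mul, add_zero, Finset.sum_div, mul_div_assoc]
  rw [h, le_div_iff₀ (by positivity), zero_mul]

/-- The indicator that a neuron with weight `w` is active on both inputs `u` and `v`. -/
def coactive {d : ℕ} (u v w : Fin d → ℝ) : ℝ :=
  (if 0 ≤ w ⬝ᵥ u then (1 : ℝ) else 0) * (if 0 ≤ w ⬝ᵥ v then (1 : ℝ) else 0)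

lemma measurable_dotProduct_left {d : ℕ} (u : Fin d → ℝ) :
    Measurable fun w : Fin d → ℝ => w ⬝ᵥ u := by
  unfold dotProduct
  fun_prop

lemma measurable_coactive {d : ℕ} (u v : Fin d → ℝ) : Measurable (coactive u v) :=
  (Measurable.ite (measurableSet_le measurable_const (measurable_dotProduct_left u))
    measurable_const measurable_const).mul
  (Measurable.ite (measurableSet_le measurable_const (measurable_dotProduct_left v))
    measurable_const measurable_const)

lemma coactive_mem_Icc {d : ℕ} (u v w : Fin d → ℝ) : coactive u v w ∈ Set.Icc (0 : ℝ) 1 := by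
  unfold coactive
  split_ifs <;> simp

lemma integral_coactive {d : ℕ} {s : ℝ≥0} (hs : s ≠ 0) {u v : Fin d → ℝ} (hu : u ⬝ᵥ u = 1)
    (hv : v ⬝ᵥ v = 1) (h₁ : -1 ≤ u ⬝ᵥ v) (h₂ : u ⬝ᵥ v ≤ 1) :
    ∫ w, coactive u v w ∂(Measure.pi fun _ : Fin d => gaussianReal 0 s) =
      (Real.pi - Real.arccos (u ⬝ᵥ v)) / (2 * Real.pi) := by
  have hpi := Real.pi_pos
  have hQ : MeasurableSet {z : ℝ × ℝ | 0 ≤ z.1 ∧ 0 ≤ z.2} :=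
    (measurableSet_le measurable_const measurable_fst).inter
      (measurableSet_le measurable_const measurable_snd)
  have hm : Measurable fun w : Fin d → ℝ => (w ⬝ᵥ u, w ⬝ᵥ v) :=
    (measurable_dotProduct_left u).prodMk (measurable_dotProduct_left v)
  have hfun : coactive u v =
      ((fun w : Fin d → ℝ => (w ⬝ᵥ u, w ⬝ᵥ v)) ⁻¹' {z : ℝ × ℝ | 0 ≤ z.1 ∧ 0 ≤ z.2}).indicator
        1 := by
    funext w
    by_cases h1 : 0 ≤ w ⬝ᵥ u <;> by_cases h2 : 0 ≤ w ⬝ᵥ v <;>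
      simp [coactive, h1, h2]
  rw [hfun, integral_indicator_one (hm hQ), measureReal_def, ← Measure.map_apply hm hQ,
    map_dotProduct_pi_gaussianReal s u v (Real.arccos (u ⬝ᵥ v)) hu hv (Real.cos_arccos h₁ h₂).symm,
    Measure.map_apply (by fun_prop) hQ]
  have h := gaussianReal_prod_quadrant hs (Real.arccos_nonneg (u ⬝ᵥ v)) (Real.arccos_le_pi _)
  refine (congrArg ENNReal.toReal h).trans (ENNReal.toReal_ofReal ?_)
  have := Real.arccos_le_pi (u ⬝ᵥ v)
  exact div_nonneg (by linarith) (by positivity)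

lemma dotProduct_mem_Icc_of_unit {d : ℕ} {u v : Fin d → ℝ} (hu : u ⬝ᵥ u = 1)
    (hv : v ⬝ᵥ v = 1) : u ⬝ᵥ v ∈ Set.Icc (-1 : ℝ) 1 := by
  have h := Finset.sum_mul_sq_le_sq_mul_sq Finset.univ u v
  simp only [dotProduct, ← sq] at hu hv
  rw [hu, hv, one_mul, sq_le_one_iff_abs_le_one] at h
  exact abs_le.1 h

lemma abs_Hinf_sub_Hstep_le {d n m : ℕ} (hm : 0 < m) {x : Fin n → Fin d → ℝ}
    (hx : ∀ i, x i ⬝ᵥ x i = 1) {s : ℝ≥0} (hs : s ≠ 0) (W : Fin m → Fin d → ℝ) (i j : Fin n) :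
    |(Hinf x - Hstep x (tildeW0 W)) i j| ≤
      |∑ r, (coactive (x i) (x j) (W r) -
        ∫ w, coactive (x i) (x j) w ∂(Measure.pi fun _ : Fin d => gaussianReal 0 s))| / m := by
  have hm' : (0 : ℝ) < m := by exact_mod_cast hm
  have hpi := Real.pi_pos
  obtain ⟨h₁, h₂⟩ := dotProduct_mem_Icc_of_unit (hx i) (hx j)
  have hentry : (Hinf x - Hstep x (tildeW0 W)) i j =
      -((x i ⬝ᵥ x j + 1) / 2) * ((∑ r, (coactive (x i) (x j) (W r) -
        ∫ w, coactive (x i) (x j) w ∂(Measure.pi fun _ : Fin d => gaussianReal 0 s))) / m) := by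
    rw [integral_coactive hs (hx i) (hx j) h₁ h₂]
    simp only [Matrix.sub_apply, Hinf, Hstep, of_apply, tildeX_dotProduct_tildeX,
      tildeW0_dotProduct_tildeX_nonneg, Finset.sum_sub_distrib, Finset.sum_const,
      Finset.card_univ, Fintype.card_fin, nsmul_eq_mul, coactive]
    field_simp
    ring
  rw [hentry, abs_mul, abs_neg, abs_div _ (m : ℝ), abs_of_pos hm']
  refine mul_le_of_le_one_left (by positivity) ?_
  rw [abs_of_nonneg (by linarith)]
  linarith

instance {d m : ℕ} (κ : ℝ) : IsProbabilityMeasure (gaussVec d m κ) := by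
  unfold gaussVec
  infer_instance

lemma gaussVec_abs_Hinf_sub_Hstep_gt_le {d n m : ℕ} (hm : 0 < m) {x : Fin n → Fin d → ℝ}
    (hx : ∀ i, x i ⬝ᵥ x i = 1) {κ : ℝ} (hκ : 0 < κ) {t : ℝ} (ht : 0 ≤ t) (i j : Fin n) :
    (gaussVec d m κ).real {W | t < |(Hinf x - Hstep x (tildeW0 W)) i j|} ≤
      2 * Real.exp (-(2 * m * t ^ 2)) := by
  have hm' : (0 : ℝ) < m := by exact_mod_cast hm
  have hs : Real.toNNReal (κ ^ 2) ≠ 0 := (Real.toNNReal_pos.2 (by positivity)).ne'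
  have hsub : {W | t < |(Hinf x - Hstep x (tildeW0 W)) i j|} ⊆
      {W : Fin m → Fin d → ℝ | m * t ≤ |∑ r, (coactive (x i) (x j) (W r) -
        ∫ w, coactive (x i) (x j) w
          ∂(Measure.pi fun _ : Fin d => gaussianReal 0 (Real.toNNReal (κ ^ 2))))|} := by
    intro W hW
    have h := (show t < _ from hW).le.trans (abs_Hinf_sub_Hstep_le hm hx hs W i j)
    rw [le_div_iff₀' hm'] at h
    exact h
  refine (measureReal_mono hsub).trans ((measureReal_pi_abs_sum_sub_integral_ge_le _
    (measurable_coactive (x i) (x j)) (coactive_mem_Icc (x i) (x j)) (by positivity)).trans_eq ?_)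
  congr 3
  field_simp

lemma gaussVec_exists_abs_Hinf_sub_Hstep_gt_le {d n m : ℕ} (hm : 0 < m) {x : Fin n → Fin d → ℝ}
    (hx : ∀ i, x i ⬝ᵥ x i = 1) {κ : ℝ} (hκ : 0 < κ) {t : ℝ} (ht : 0 ≤ t) :
    (gaussVec d m κ).real {W | ∃ i j, t < |(Hinf x - Hstep x (tildeW0 W)) i j|} ≤
      2 * n ^ 2 * Real.exp (-(2 * m * t ^ 2)) := by
  simp only [Set.ofPred_exists]
  refine (measureReal_iUnion_fintype_le _).trans ((Finset.sum_le_sum fun i _ =>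
    (measureReal_iUnion_fintype_le _).trans (Finset.sum_le_sum fun j _ =>
      gaussVec_abs_Hinf_sub_Hstep_gt_le hm hx hκ ht i j)).trans_eq ?_)
  simp only [Finset.sum_const, Finset.card_univ, Fintype.card_fin, nsmul_eq_mul]
  ring

lemma two_mul_sq_mul_exp_le {n m : ℕ} (hm : 0 < m) {δ : ℝ} (hδ : 0 < δ) (hδ1 : δ < 1) :
    2 * n ^ 2 * Real.exp (-(2 * m * (2 * Real.sqrt (Real.log (2 * n / δ) / m)) ^ 2)) ≤ δ := by
  rcases Nat.eq_zero_or_pos n with rfl | hn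
  · simpa using hδ.le
  have hm' : (0 : ℝ) < m := by exact_mod_cast hm
  have hn' : (1 : ℝ) ≤ n := by exact_mod_cast hn
  have hL : 0 ≤ Real.log (2 * n / δ) :=
    Real.log_nonneg ((one_le_div hδ).2 (by linarith))
  have hexp : Real.exp (-(2 * m * (2 * Real.sqrt (Real.log (2 * n / δ) / m)) ^ 2)) ≤
      (δ / (2 * n)) ^ 2 := by
    rw [mul_pow, Real.sq_sqrt (by positivity),
      ← Real.exp_log (show 0 < (δ / (2 * n)) ^ 2 by positivity), Real.exp_le_exp, Real.log_pow,
      ← inv_div (2 * (n : ℝ)) δ, Real.log_inv]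
    field_simp
    push_cast
    linarith
  calc _ ≤ 2 * (n : ℝ) ^ 2 * (δ / (2 * n)) ^ 2 := by gcongr
    _ = δ ^ 2 / 2 := by field_simp
    _ ≤ δ := by nlinarith

/-- **Concentration of `H(0)` around `H∞`.** For every `δ ∈ (0,1)`, with probability at
least `1 − δ` over the random initialization,
`‖(H∞ − H(0))P‖_P ≤ 2 M_I M_P n √(log(2n/δ)/m)`. -/
theorem Hzero_concentration {d n m : ℕ} (hd : 2 ≤ d) (hm : 0 < m)
    (x : Fin n → Fin d → ℝ) (hx : ∀ i, x i ⬝ᵥ x i = 1) (hinj : Function.Injective x)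
    (P : Matrix (Fin n) (Fin n) ℝ) (hP : P.PosDef)
    (κ : ℝ) (hκ : 0 < κ) (δ : ℝ) (hδ : 0 < δ) (hδ1 : δ < 1) :
    ENNReal.ofReal (1 - δ) ≤
      gaussVec d m κ
        {W | pOpNorm P ((Hinf x - Hstep x (tildeW0 W)) * P) ≤
          2 * constMI P * constMP P * n * Real.sqrt (Real.log (2 * n / δ) / m)} := by
  set t := 2 * Real.sqrt (Real.log (2 * n / δ) / m) with ht_def
  have ht : 0 ≤ t := by positivity
  set bad := {W : Fin m → Fin d → ℝ | ∃ i j, t < |(Hinf x - Hstep x (tildeW0 W)) i j|}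
  set good := {W : Fin m → Fin d → ℝ | pOpNorm P ((Hinf x - Hstep x (tildeW0 W)) * P) ≤
    2 * constMI P * constMP P * n * Real.sqrt (Real.log (2 * n / δ) / m)}
  have hbad : (gaussVec d m κ).real bad ≤ δ :=
    (gaussVec_exists_abs_Hinf_sub_Hstep_gt_le hm hx hκ ht).trans (two_mul_sq_mul_exp_le hm hδ hδ1)
  have hcover : Set.univ ⊆ good ∪ bad := by
    intro W _
    refine or_iff_not_imp_right.2 fun hW => ?_
    have hA : ∀ i j, |(Hinf x - Hstep x (tildeW0 W)) i j| ≤ t := fun i j =>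
      not_lt.1 fun h => hW ⟨i, j, h⟩
    refine (pOpNorm_mul_le hP.posSemidef ht hA).trans_eq ?_
    rw [ht_def]
    ring
  have htotal : 1 ≤ (gaussVec d m κ).real good + (gaussVec d m κ).real bad := by
    rw [← probReal_univ (μ := gaussVec d m κ)]
    exact (measureReal_mono hcover).trans (measureReal_union_le _ _)
  rw [← ofReal_measureReal]
  exact ENNReal.ofReal_le_ofReal (by linarith)

end
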